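/- For every integer N ≥ 2, every global minimizer (f1, g1, l1, m1, c_fl, c_mg, c_ba, t) of the identity-bridge lower-bound problem satisfies g1 > 0. -/

import Mathlib

/-- The objective `G` of the lower-bound problems:
`G = √((c_fl² + c_mg² + N·c_ba²)/2) + (N−1)·√((f1−m1)² + (g1−l1)² + 4t)`. -/
noncomputable def Gobj (N : ℕ) (f1 g1 l1 m1 cfl cmg cba t : ℝ) : ℝ :=
  Real.sqrt ((cfl ^ 2 + cmg ^ 2 + N * cba ^ 2) / 2) +
    ((N : ℝ) - 1) * Real.sqrt ((f1 - m1) ^ 2 + (g1 - l1) ^ 2 + 4 * t)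

/-- Feasible set of the identity-bridge lower-bound problem. -/
def FeasIdnLB (N : ℕ) (f1 g1 l1 m1 cfl cmg cba t : ℝ) : Prop :=
  1 ≤ f1 ∧ 1 ≤ l1 ∧ 1 ≤ m1 ∧
  ((N : ℝ) - 1) * f1 + cfl + N * cba + N ≤ ((N : ℝ) - 1) * l1 ∧
  ((N : ℝ) - 1) * l1 + N ≤ ((N : ℝ) - 1) * f1 + cfl ∧
  ((N : ℝ) - 1) * g1 + N ≤ ((N : ℝ) - 1) * m1 + cmg ∧
  -g1 + N ≤ ((N : ℝ) - 1) * m1 + cmg ∧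
  f1 * m1 ≤ t ∧
  g1 * l1 ≤ t

/-- The objective at a feasible point with `g1 ≤ 0` is at least its value at a feasible point with
`g1 = 0`, `l1 = 1`, `cba = -2` and all other constraints but the bounds on `f1`, `m1` tight. -/
lemma exists_tight_le_Gobj {N : ℕ} (hN : 2 ≤ N) {f1 g1 l1 m1 cfl cmg cba t : ℝ}
    (hfeas : FeasIdnLB N f1 g1 l1 m1 cfl cmg cba t) (hg : g1 ≤ 0) :
    ∃ f m : ℝ, 1 ≤ f ∧ 1 ≤ m ∧ ((N : ℝ) - 1) * (f - 1) ≤ N ∧ ((N : ℝ) - 1) * m ≤ N ∧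
      Gobj N f 0 1 m (N - ((N : ℝ) - 1) * (f - 1)) (N - ((N : ℝ) - 1) * m) (-2) (f * m) ≤
        Gobj N f1 g1 l1 m1 cfl cmg cba t := by
  obtain ⟨hf, hl, hm, h1, h2, -, h4, h5, -⟩ := hfeas
  have hN' : (2 : ℝ) ≤ N := by exact_mod_cast hN
  have hn : (0 : ℝ) < (N : ℝ) - 1 := by linarith
  have hba : 2 ^ 2 ≤ cba ^ 2 := by
    have : cba ≤ -2 := by
      have : (N : ℝ) * cba ≤ N * (-2) := by linarith
      exact le_of_mul_le_mul_left this (by linarith)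
    nlinarith
  obtain ⟨f, hf1, hff, hfN, hfc⟩ : ∃ f : ℝ, 1 ≤ f ∧ f ≤ f1 ∧ ((N : ℝ) - 1) * (f - 1) ≤ N ∧
      (N - ((N : ℝ) - 1) * (f - 1)) ^ 2 ≤ cfl ^ 2 := by
    rcases le_total (((N : ℝ) - 1) * (f1 - 1)) N with h | h
    · refine ⟨f1, hf, le_rfl, h, pow_le_pow_left₀ (by linarith) ?_ 2⟩
      nlinarith
    · have e : ((N : ℝ) - 1) * (1 + N / (N - 1) - 1) = N := by field_simp; ring
      refine ⟨1 + N / (N - 1), ?_, ?_, e.le, ?_⟩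
      · have : (0 : ℝ) ≤ N / (N - 1) := by positivity
        linarith
      · exact le_of_mul_le_mul_left (by linarith) hn
      · rw [e, sub_self]; nlinarith [sq_nonneg cfl]
  obtain ⟨m, hm1, hmm, hmN, hmc⟩ : ∃ m : ℝ, 1 ≤ m ∧ m ≤ m1 ∧ ((N : ℝ) - 1) * m ≤ N ∧
      (N - ((N : ℝ) - 1) * m) ^ 2 ≤ cmg ^ 2 := by
    rcases le_total (((N : ℝ) - 1) * m1) N with h | h
    · exact ⟨m1, hm, le_rfl, h, pow_le_pow_left₀ (by linarith) (by linarith) 2⟩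
    · have e : ((N : ℝ) - 1) * (N / (N - 1)) = N := by field_simp
      refine ⟨N / (N - 1), ?_, ?_, e.le, ?_⟩
      · rw [one_le_div hn]; linarith
      · exact le_of_mul_le_mul_left (by linarith) hn
      · rw [e, sub_self]; nlinarith [sq_nonneg cmg]
  refine ⟨f, m, hf1, hm1, hfN, hmN, add_le_add (Real.sqrt_le_sqrt ?_)
    (mul_le_mul_of_nonneg_left (Real.sqrt_le_sqrt ?_) hn.le)⟩
  · have : (N : ℝ) * (-2) ^ 2 ≤ N * cba ^ 2 := by
      nlinarith
    linarith
  · have : (f + m) ^ 2 ≤ (f1 + m1) ^ 2 := by gcongr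
    nlinarith

/-- The tangent line bound for the square root at `A ^ 2`. -/
lemma sqrt_sq_add_le {A x : ℝ} (hA : 0 < A) (hx : 0 ≤ A ^ 2 + x) :
    √(A ^ 2 + x) ≤ A + x / (2 * A) := by
  have e : A + x / (2 * A) = (A ^ 2 + (A ^ 2 + x)) / (2 * A) := by field_simp; ring
  refine Real.sqrt_le_iff.2 ⟨e ▸ by positivity, ?_⟩
  have : (A + x / (2 * A)) ^ 2 = A ^ 2 + x + (x / (2 * A)) ^ 2 := by field_simp; ring
  rw [this]
  exact le_add_of_nonneg_right (sq_nonneg _)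

/-- A tight feasible point with `g1 = 0` is strictly improved by raising `g1` slightly. -/
lemma exists_feas_Gobj_lt {N : ℕ} (hN : 2 ≤ N) {f m : ℝ} (hf : 1 ≤ f) (hm : 1 ≤ m)
    (hfN : ((N : ℝ) - 1) * (f - 1) ≤ N) (hmN : ((N : ℝ) - 1) * m ≤ N) :
    ∃ g c : ℝ, FeasIdnLB N f g 1 m (N - ((N : ℝ) - 1) * (f - 1)) c (-2) (f * m) ∧
      Gobj N f g 1 m (N - ((N : ℝ) - 1) * (f - 1)) c (-2) (f * m) <
        Gobj N f 0 1 m (N - ((N : ℝ) - 1) * (f - 1)) (N - ((N : ℝ) - 1) * m) (-2) (f * m) := by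
  have hN' : (2 : ℝ) ≤ N := by exact_mod_cast hN
  unfold Gobj FeasIdnLB
  set n : ℝ := (N : ℝ) - 1 with hn
  have hn1 : 1 ≤ n := by linarith
  set c : ℝ := N - n * m with hc
  set d : ℝ := N - n * (f - 1) with hd
  have hc0 : 0 ≤ c := by linarith
  set A := √((d ^ 2 + c ^ 2 + N * (-2) ^ 2) / 2) with hA
  set R := √((f - m) ^ 2 + (0 - 1) ^ 2 + 4 * (f * m)) with hR
  have hA2 : A ^ 2 = (d ^ 2 + c ^ 2 + N * (-2) ^ 2) / 2 := Real.sq_sqrt (by positivity)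
  have hR2 : R ^ 2 = (f - m) ^ 2 + (0 - 1) ^ 2 + 4 * (f * m) := Real.sq_sqrt (by positivity)
  have hA0 : 0 < A := Real.sqrt_pos.2 (by positivity)
  have hR0 : 0 < R := Real.sqrt_pos.2 (by positivity)
  have key : c * R < 2 * A := by
    rcases hc0.eq_or_lt with h0 | h0
    · rw [← h0]; linarith
    have hf3 : f ≤ 3 := by nlinarith
    have h1 : c * (f + m) ≤ 4 := by
      have : c = 1 - n * (m - 1) := by rw [hc, hn]; ring
      nlinarith [mul_nonneg (sub_nonneg.2 hm) (sub_nonneg.2 hn1),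
        mul_nonneg (mul_nonneg (sub_nonneg.2 hm) (by linarith : 0 ≤ n))
          (by linarith : 0 ≤ f + m - 1)]
    have h2 : (c * (f + m)) ^ 2 ≤ 4 ^ 2 := pow_le_pow_left₀ (by positivity) h1 2
    refine lt_of_pow_lt_pow_left₀ 2 (by positivity) ?_
    rw [mul_pow, mul_pow, hA2, hR2]
    nlinarith [pow_pos h0 2, sq_nonneg d]
  clear_value A R
  obtain ⟨ε, hε0, hε1, hε⟩ : ∃ ε : ℝ, 0 < ε ∧ ε ≤ 1 ∧ ε * (n * R + 2 * A) = 2 * A - c * R := by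
    have hp : 0 < n * R + 2 * A := by positivity
    refine ⟨(2 * A - c * R) / (n * R + 2 * A), div_pos (by linarith) hp, ?_,
      div_mul_cancel₀ _ hp.ne'⟩
    rw [div_le_one hp]
    nlinarith [mul_nonneg hc0 hR0.le, mul_pos (by linarith : 0 < n) hR0]
  have hfm : 1 ≤ f * m := one_le_mul_of_one_le_of_one_le hf hm
  refine ⟨ε, c + n * ε, ⟨hf, le_rfl, hm, by linarith, by linarith, by linarith, ?_, le_rfl,
    by linarith⟩, ?_⟩
  · nlinarith
  clear_value c d
  have hA' : √((d ^ 2 + (c + n * ε) ^ 2 + N * (-2) ^ 2) / 2) ≤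
      A + n * ε * (2 * c + n * ε) / 2 / (2 * A) := by
    convert sqrt_sq_add_le hA0 (x := n * ε * (2 * c + n * ε) / 2) ?_ using 2
    · rw [hA2]; ring
    · positivity
  have hR' : √((f - m) ^ 2 + (ε - 1) ^ 2 + 4 * (f * m)) ≤ R + -(ε * (2 - ε)) / (2 * R) := by
    have e : (f - m) ^ 2 + (ε - 1) ^ 2 + 4 * (f * m) = R ^ 2 + -(ε * (2 - ε)) := by
      rw [hR2]; ring
    rw [e]
    refine sqrt_sq_add_le hR0 ?_
    rw [← e]; positivity
  have hlt : n * ε * (2 * c + n * ε) / 2 / (2 * A) < n * (ε * (2 - ε) / (2 * R)) := by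
    rw [div_div, ← mul_div_assoc, div_lt_div_iff₀ (by positivity) (by positivity)]
    have h1 : 0 < (2 - ε) * (2 * A) - (2 * c + n * ε) * R := by linarith
    have h2 : 0 < n * ε * (2 * ((2 - ε) * (2 * A) - (2 * c + n * ε) * R)) := by positivity
    linarith
  have := mul_le_mul_of_nonneg_left hR' (by linarith : 0 ≤ n)
  rw [neg_div, mul_add, mul_neg] at this
  linarith

/-- Every global minimizer of the identity-bridge
lower-bound problem satisfies `g1 > 0`. -/
theorem identity_bridge_minimizer_g1_pos (N : ℕ) (hN : 2 ≤ N)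
    (f1 g1 l1 m1 cfl cmg cba t : ℝ)
    (hfeas : FeasIdnLB N f1 g1 l1 m1 cfl cmg cba t)
    (hmin : ∀ f1' g1' l1' m1' cfl' cmg' cba' t' : ℝ,
      FeasIdnLB N f1' g1' l1' m1' cfl' cmg' cba' t' →
      Gobj N f1 g1 l1 m1 cfl cmg cba t ≤ Gobj N f1' g1' l1' m1' cfl' cmg' cba' t') :
    0 < g1 := by
  by_contra! hg
  obtain ⟨f, m, hf, hm, hfN, hmN, hle⟩ := exists_tight_le_Gobj hN hfeas hg
  obtain ⟨g, c, hfeas', hlt⟩ := exists_feas_Gobj_lt hN hf hm hfN hmN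
  exact absurd (hmin _ _ _ _ _ _ _ _ hfeas') (hlt.trans_le hle).not_ge
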